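/- Let n ≥ m ≥ 1, let A and B be real n×m matrices with A of full column rank, and let d ∈ ℝⁿ satisfy Bᵀd = 0. Then, with A† := (AᵀA)⁻¹Aᵀ and R(A) := A·A† the orthogonal projection onto the column space of A, one has ‖R(A)·d‖ ≤ ‖A†‖·‖A − B‖·‖d‖, where matrix norms are spectral. -/

import Mathlib

open Matrix

/-- Spectral (ℓ²-operator) norm of a real rectangular matrix. -/
noncomputable def spec {n m : ℕ} (A : Matrix (Fin n) (Fin m) ℝ) : ℝ :=
  ‖LinearMap.toContinuousLinearMap (Matrix.toEuclideanLin A)‖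

section L2Operator

open scoped Matrix.Norms.L2Operator

theorem spec_eq_l2_opNorm {n m : ℕ} (A : Matrix (Fin n) (Fin m) ℝ) : spec A = ‖A‖ := rfl

theorem spec_transpose {n m : ℕ} (A : Matrix (Fin n) (Fin m) ℝ) : spec Aᵀ = spec A := by
  rw [spec_eq_l2_opNorm, spec_eq_l2_opNorm, ← Matrix.conjTranspose_eq_transpose_of_trivial,
    Matrix.l2_opNorm_conjTranspose]

end L2Operator

theorem norm_toEuclideanLin_le_spec {n m : ℕ} (A : Matrix (Fin n) (Fin m) ℝ)
    (x : EuclideanSpace ℝ (Fin m)) : ‖Matrix.toEuclideanLin A x‖ ≤ spec A * ‖x‖ :=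
  (LinearMap.toContinuousLinearMap (Matrix.toEuclideanLin A)).le_opNorm x

theorem toEuclideanLin_mul_apply {l m n : ℕ} (A : Matrix (Fin l) (Fin m) ℝ)
    (B : Matrix (Fin m) (Fin n) ℝ) (x : EuclideanSpace ℝ (Fin n)) :
    Matrix.toEuclideanLin (A * B) x = Matrix.toEuclideanLin A (Matrix.toEuclideanLin B x) := by
  simp [Matrix.toLpLin_apply, Matrix.mulVec_mulVec]

theorem spec_nonneg {n m : ℕ} (A : Matrix (Fin n) (Fin m) ℝ) : 0 ≤ spec A := norm_nonneg _

/-- The orthogonal projection `A * A†` is symmetric, so it equals `A†ᵀ * Aᵀ`. -/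
theorem mul_pinv_eq_transpose_mul {n m : ℕ} (A : Matrix (Fin n) (Fin m) ℝ) :
    A * ((Aᵀ * A)⁻¹ * Aᵀ) = ((Aᵀ * A)⁻¹ * Aᵀ)ᵀ * Aᵀ := by
  simp [Matrix.transpose_nonsing_inv, Matrix.mul_assoc]

/-- **Projection of a null-space vector** (paper's Lemma on `‖R(∇c(x))d_S‖`).
If `A` has full column rank, `d ∈ ℝⁿ` satisfies `Bᵀd = 0`, `A† = (AᵀA)⁻¹Aᵀ`, and
`R(A) = A·A†` is the orthogonal projection onto the column space of `A`, then
`‖R(A)d‖ ≤ ‖A†‖·‖A − B‖·‖d‖`. -/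
theorem range_projection_of_nullspace_vector_bound
    {n m : ℕ} (hm : 1 ≤ m) (hmn : m ≤ n)
    (A B : Matrix (Fin n) (Fin m) ℝ)
    (hA : A.rank = m)
    (d : EuclideanSpace ℝ (Fin n))
    (hd : Matrix.toEuclideanLin Bᵀ d = 0) :
    ‖Matrix.toEuclideanLin (A * ((Aᵀ * A)⁻¹ * Aᵀ)) d‖ ≤
      spec ((Aᵀ * A)⁻¹ * Aᵀ) * spec (A - B) * ‖d‖ := by
  have h_sub : Matrix.toEuclideanLin Aᵀ d = Matrix.toEuclideanLin (A - B)ᵀ d := by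
    rw [Matrix.transpose_sub, map_sub, LinearMap.sub_apply, hd, sub_zero]
  rw [mul_pinv_eq_transpose_mul, toEuclideanLin_mul_apply, h_sub]
  calc _ ≤ spec ((Aᵀ * A)⁻¹ * Aᵀ)ᵀ * ‖Matrix.toEuclideanLin (A - B)ᵀ d‖ :=
        norm_toEuclideanLin_le_spec _ _
    _ ≤ spec ((Aᵀ * A)⁻¹ * Aᵀ)ᵀ * (spec (A - B)ᵀ * ‖d‖) :=
        mul_le_mul_of_nonneg_left (norm_toEuclideanLin_le_spec _ _) (spec_nonneg _)
    _ = _ := by rw [spec_transpose, spec_transpose, mul_assoc]
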